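/- Let A be an integrally closed local Noetherian domain which is not catenary. Then there exist a prime ideal p of A and an integer n ≥ 2 such that p^(n) ≠ pⁿ. -/

import Mathlib

noncomputable section

/-- The `n`-th symbolic power `p^(n) := pⁿA_p ∩ A` of a prime ideal `p`. -/
def symbolicPower (A : Type*) [CommRing A] (p : Ideal A) [p.IsPrime] (n : ℕ) : Ideal A :=
  Ideal.comap (algebraMap A (Localization.AtPrime p))
    (Ideal.map (algebraMap A (Localization.AtPrime p)) (p ^ n))

/-- A ring is catenary if any two saturated chains of prime ideals with the same endpoints
have the same length. -/
def IsCatenary (A : Type*) [CommRing A] : Prop :=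
  ∀ c d : LTSeries (PrimeSpectrum A),
    c.head = d.head → c.last = d.last →
    (∀ i : Fin c.length, c.toFun i.castSucc ⋖ c.toFun i.succ) →
    (∀ i : Fin d.length, d.toFun i.castSucc ⋖ d.toFun i.succ) →
    c.length = d.length

open LaurentPolynomial

section
variable {A : Type*} [CommRing A]

/-- The extended Rees algebra `A[IT, T⁻¹]` of an ideal `I`: the Laurent polynomials whose `i`-th
coefficient lies in `I ^ i`, where `I ^ i = A` for `i ≤ 0`. -/
def extendedReesAlgebra (I : Ideal A) : Subalgebra A A[T;T⁻¹] where
  carrier := {f | ∀ i, f.coeff i ∈ I ^ i.toNat}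
  mul_mem' {f g} hf hg m := by
    classical
    rw [AddMonoidAlgebra.coeff_mul]
    refine Ideal.sum_mem _ fun i _ ↦ Ideal.sum_mem _ fun j _ ↦ ?_
    dsimp only
    split_ifs with h
    · refine Ideal.pow_le_pow_right (show m.toNat ≤ i.toNat + j.toNat by lia) ?_
      rw [pow_add]
      exact Ideal.mul_mem_mul (hf i) (hg j)
    · exact zero_mem _
  add_mem' {f g} hf hg i := by
    simpa using add_mem (hf i) (hg i)
  algebraMap_mem' r i := by
    rw [← C_eq_algebraMap, C_apply]
    split_ifs with h
    · simp [h]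
    · exact zero_mem _

namespace extendedReesAlgebra

variable {I : Ideal A}

theorem C_mul_T_mem {a : A} {i : ℤ} (ha : a ∈ I ^ i.toNat) :
    C a * T i ∈ extendedReesAlgebra I := fun j ↦ by
  rw [← single_eq_C_mul_T, AddMonoidAlgebra.coeff_single, Finsupp.single_apply]
  split_ifs with h
  · exact h ▸ ha
  · exact zero_mem _

variable (I) in
/-- The element `T⁻¹` of the extended Rees algebra. -/
noncomputable def invT : extendedReesAlgebra I :=
  ⟨T (-1), by simpa using C_mul_T_mem (I := I) (a := 1) (i := -1)⟩

/-- The element `aT` of the extended Rees algebra, for `a ∈ I`. -/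
noncomputable def smulT (a : I) : extendedReesAlgebra I :=
  ⟨C a.1 * T 1, C_mul_T_mem (by simp)⟩

theorem algebraMap_eq_invT_mul_smulT (a : I) :
    algebraMap A (extendedReesAlgebra I) a = invT I * smulT a := by
  apply Subtype.ext
  change algebraMap A A[T;T⁻¹] a = T (-1) * (C a.1 * T 1)
  rw [mul_left_comm, ← T_add, ← C_eq_algebraMap]
  simp

theorem invT_dvd_iff {f : extendedReesAlgebra I} :
    invT I ∣ f ↔ ∀ i : ℤ, f.1.coeff i ∈ I ^ (i + 1).toNat := by
  have coeff_T_mul (n : ℤ) (g : A[T;T⁻¹]) (i : ℤ) : (T n * g).coeff i = g.coeff (i - n) := by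
    rw [T, AddMonoidAlgebra.coeff_single_mul_apply]
    simp [sub_eq_neg_add]
  constructor
  · rintro ⟨g, rfl⟩ i
    change (T (-1) * g.1).coeff i ∈ _
    rw [coeff_T_mul]
    simpa using g.2 (i + 1)
  · intro h
    refine ⟨⟨T 1 * f.1, fun i ↦ ?_⟩, Subtype.ext ?_⟩
    · rw [coeff_T_mul]
      simpa using h (i - 1)
    · change f.1 = T (-1) * (T 1 * f.1)
      rw [← mul_assoc, ← T_add]
      simp

theorem adjoin_eq_top {s : Set A} (hs : Ideal.span s = I) :
    Algebra.adjoin A (insert (T (-1)) ((fun a ↦ C a * T 1) '' s)) = extendedReesAlgebra I := by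
  set S := Algebra.adjoin A (insert (T (-1)) ((fun a ↦ C a * T 1) '' s))
  have hC (a : A) : C a ∈ S := by
    rw [C_eq_algebraMap]; exact S.algebraMap_mem a
  have hneg : T (-1) ∈ S := Algebra.subset_adjoin (Set.mem_insert _ _)
  have hone {a : A} (ha : a ∈ I) : C a * T 1 ∈ S := by
    rw [← hs] at ha
    induction ha using Submodule.span_induction with
    | mem x hx => exact Algebra.subset_adjoin (Set.mem_insert_of_mem _ ⟨x, hx, rfl⟩)
    | zero => simp
    | add x y _ _ hx hy => rw [map_add, add_mul]; exact add_mem hx hy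
    | smul a x _ hx => rw [smul_eq_mul, map_mul, mul_assoc]; exact mul_mem (hC a) hx
  have hpow (n : ℕ) : ∀ a ∈ I ^ n, C a * T n ∈ S := by
    induction n with
    | zero => intro a _; simpa using hC a
    | succ n ih =>
      intro a ha
      rw [pow_succ] at ha
      refine Submodule.smul_induction_on ha (fun r hr t ht ↦ ?_) fun x y hx hy ↦ ?_
      · have : C (r • t) * T ((n + 1 : ℕ) : ℤ) = (C r * T n) * (C t * T 1) := by
          rw [Nat.cast_succ, T_add, smul_eq_mul, map_mul]; ring
        rw [this]
        exact mul_mem (ih r hr) (hone ht)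
      · rw [map_add, add_mul]; exact add_mem hx hy
  apply le_antisymm
  · refine Algebra.adjoin_le ?_
    rintro _ (rfl | ⟨a, ha, rfl⟩)
    · exact (invT I).2
    · exact (smulT ⟨a, hs ▸ Ideal.subset_span ha⟩).2
  · intro f hf
    rw [← AddMonoidAlgebra.sum_coeff_single f]
    refine sum_mem fun i _ ↦ ?_
    rw [single_eq_C_mul_T]
    obtain ⟨n, rfl | rfl⟩ := i.eq_nat_or_neg
    · exact hpow n _ (by simpa using hf n)
    · refine mul_mem (hC _) ?_
      have := pow_mem hneg n
      rw [T_pow] at this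
      simpa using this

/-- For `I ≤ J`, taking the constant coefficient modulo `J` is a ring homomorphism on the extended
Rees algebra. -/
def constantCoeffMod {J : Ideal A} (h : I ≤ J) : extendedReesAlgebra I →+* A ⧸ J where
  toFun f := Ideal.Quotient.mk J (f.1.coeff 0)
  map_one' := by
    change Ideal.Quotient.mk J ((1 : A[T;T⁻¹]).coeff 0) = 1
    rw [← T_zero, T_apply]; simp
  map_zero' := by simp
  map_add' f g := by simp
  map_mul' f g := by
    classical
    have hpos (f : extendedReesAlgebra I) {i : ℤ} (hi : 0 < i) :
        Ideal.Quotient.mk J (f.1.coeff i) = 0 :=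
      Ideal.Quotient.eq_zero_iff_mem.mpr <|
        h (Ideal.pow_le_self (by lia) (f.2 i))
    change Ideal.Quotient.mk J ((f.1 * g.1).coeff 0) = _
    rw [AddMonoidAlgebra.coeff_mul, Finsupp.sum, map_sum, Finset.sum_eq_single 0]
    · rw [Finsupp.sum, map_sum, Finset.sum_eq_single 0]
      · simp
      · intro j _ hj
        simp [hj]
      · simp +contextual
    · intro i _ hi
      rw [Finsupp.sum, map_sum]
      refine Finset.sum_eq_zero fun j _ ↦ ?_
      split_ifs with hij
      · rcases hi.lt_or_gt with hi | hi
        · rw [map_mul, hpos g (by lia), mul_zero]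
        · rw [map_mul, hpos f hi, zero_mul]
      · simp
    · intro h0
      simp [Finsupp.notMem_support_iff.mp h0]

instance [IsNoetherianRing A] : IsNoetherianRing (extendedReesAlgebra I) := by
  obtain ⟨s, hs⟩ := (IsNoetherian.noetherian I : I.FG)
  have : Algebra.FiniteType A (extendedReesAlgebra I) := by
    rw [← (extendedReesAlgebra I).fg_iff_finiteType, ← adjoin_eq_top hs]
    exact Subalgebra.fg_def.mpr ⟨_, (s.finite_toSet.image _).insert _, rfl⟩
  exact Algebra.FiniteType.isNoetherianRing A _

theorem height_add_one_le_height_ker_constantCoeffMod {q : Ideal A} [q.IsPrime] (h : I ≤ q) :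
    q.height + 1 ≤ (RingHom.ker (constantCoeffMod h)).height := by
  let f (P : Ideal A) : extendedReesAlgebra I →+* (A ⧸ P)[T;T⁻¹] :=
    (AddMonoidAlgebra.mapRingHom ℤ (Ideal.Quotient.mk P)).comp
      (extendedReesAlgebra I).val.toRingHom
  have mem_ker (P : Ideal A) (x : extendedReesAlgebra I) :
      x ∈ RingHom.ker (f P) ↔ ∀ i, x.1.coeff i ∈ P := by
    rw [RingHom.mem_ker, LaurentPolynomial.ext_iff]
    refine forall_congr' fun i ↦ ?_
    change (AddMonoidAlgebra.mapRingHom ℤ (Ideal.Quotient.mk P) x.1).coeff i = 0 ↔ _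
    rw [AddMonoidAlgebra.coeff_mapRingHom, Ideal.Quotient.eq_zero_iff_mem]
  have algebraMap_mem (P : Ideal A) (a : A) :
      algebraMap A (extendedReesAlgebra I) a ∈ RingHom.ker (f P) ↔ a ∈ P := by
    rw [mem_ker]
    change (∀ i, (algebraMap A A[T;T⁻¹] a).coeff i ∈ P) ↔ _
    simp only [← C_eq_algebraMap, C_apply]
    refine ⟨fun h ↦ by simpa using h 0, fun h i ↦ ?_⟩
    split_ifs
    exacts [h, zero_mem _]
  let F (P : PrimeSpectrum A) : PrimeSpectrum (extendedReesAlgebra I) :=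
    ⟨RingHom.ker (f P.asIdeal), RingHom.ker_isPrime _⟩
  have hF : StrictMono F := by
    refine Monotone.strictMono_of_injective ?_ ?_
    · intro P Q hPQ x hx
      exact (mem_ker _ _).mpr fun i ↦ hPQ ((mem_ker _ _).mp hx i)
    · intro P Q hPQ
      ext a
      rw [← algebraMap_mem, ← algebraMap_mem]
      exact iff_of_eq (congrArg (_ ∈ PrimeSpectrum.asIdeal ·) hPQ)
  have hlt : (F ⟨q, ‹_›⟩).asIdeal < RingHom.ker (constantCoeffMod h) := by
    refine SetLike.lt_iff_le_and_exists.mpr ⟨fun x hx ↦ ?_, invT I, ?_, fun hx ↦ ?_⟩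
    · exact Ideal.Quotient.eq_zero_iff_mem.mpr ((mem_ker _ _).mp hx 0)
    · change Ideal.Quotient.mk q ((T (-1) : A[T;T⁻¹]).coeff 0) = 0
      simp
    · have := (mem_ker _ _).mp hx (-1)
      rw [show (invT I).1 = T (-1) from rfl, T_apply, if_pos rfl] at this
      exact (Ideal.ne_top_iff_one q).mp Ideal.IsPrime.ne_top' this
  have := RingHom.ker_isPrime (constantCoeffMod h)
  have := (F ⟨q, ‹_›⟩).isPrime
  refine le_trans ?_ (Ideal.height_add_one_le_of_lt_of_isPrime hlt)
  gcongr
  have := Order.height_le_height_apply_of_strictMono F hF ⟨q, ‹_›⟩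
  rwa [← PrimeSpectrum.height_eq_orderHeight, ← PrimeSpectrum.height_eq_orderHeight] at this

theorem under_eq_of_mem_minimalPrimes {p : Ideal A} [p.IsPrime]
    (hp : ∀ (n : ℕ) (s c : A), s ∉ p → s * c ∈ p ^ n → c ∈ p ^ n)
    {P : Ideal (extendedReesAlgebra p)} (hP : P ∈ (Ideal.span {invT p}).minimalPrimes) :
    P.under A = p := by
  ext a
  rw [Ideal.under_def, Ideal.mem_comap]
  constructor
  · intro ha
    by_contra hap
    have := (Ideal.minimalPrimes_eq_comap (I := Ideal.span {invT p})).subset hP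
    obtain ⟨P', hP', rfl⟩ := this
    refine notMem_nonZeroDivisors_of_mem_mem_minimalPrimes (Ideal.mem_comap.mp ha) hP' ?_
    rw [mem_nonZeroDivisors_iff_right]
    intro y hy
    obtain ⟨y, rfl⟩ := Ideal.Quotient.mk_surjective y
    rw [← map_mul, Ideal.Quotient.eq_zero_iff_mem, Ideal.mem_span_singleton, invT_dvd_iff] at hy
    rw [Ideal.Quotient.eq_zero_iff_mem, Ideal.mem_span_singleton, invT_dvd_iff]
    intro i
    refine hp _ a _ hap ?_
    have := hy i
    rw [mul_comm, ← Algebra.smul_def] at this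
    simpa using this
  · intro ha
    rw [algebraMap_eq_invT_mul_smulT ⟨a, ha⟩]
    exact P.mul_mem_right _ (hP.le (Ideal.mem_span_singleton_self _))

end extendedReesAlgebra
end

theorem LTSeries.height_head_add_length_le {α : Type*} [Preorder α] (l : LTSeries α) :
    Order.height l.head + l.length ≤ Order.height l.last := by
  suffices h : ∀ i : Fin (l.length + 1), Order.height l.head + (i : ℕ) ≤ Order.height (l i) from
    h (Fin.last _)
  intro i
  induction i using Fin.induction with
  | zero => simp; rfl
  | succ i ih =>
    refine le_trans ?_ (Order.height_add_one_le (l.step i))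
    simpa [add_assoc] using add_le_add_left ih 1

namespace MvPolynomial

theorem height_map_quotientMk_le_card_add_one {A σ : Type*} [CommRing A] [IsNoetherianRing A]
    [Fintype σ] {p q : Ideal A} [p.IsPrime] [q.IsPrime] (hpq : p < q)
    (hcov : ∀ N : Ideal A, N.IsPrime → p < N → N ≤ q → N = q)
    (P : Ideal (MvPolynomial σ A)) [P.IsPrime] (hX : ∀ i, X i ∈ P) (hP : P.under A = q) :
    (P.map (Ideal.Quotient.mk (p.map (algebraMap A (MvPolynomial σ A))))).height ≤
      (Fintype.card σ + 1 : ℕ) := by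
  classical
  set K := p.map (algebraMap A (MvPolynomial σ A))
  obtain ⟨t, htq, htp⟩ := SetLike.exists_of_lt hpq
  have hC {a : A} : C a ∈ P ↔ a ∈ q := by rw [← hP]; rfl
  have hKP : K ≤ P := Ideal.map_le_iff_le_comap.mpr fun a ha ↦ hC.mpr (hpq.le ha)
  let s : Finset (MvPolynomial σ A ⧸ K) :=
    insert (Ideal.Quotient.mk K (C t)) (Finset.univ.image fun i ↦ Ideal.Quotient.mk K (X i))
  have hcard : s.card ≤ Fintype.card σ + 1 :=
    (Finset.card_insert_le _ _).trans (Nat.succ_le_succ Finset.card_image_le)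
  refine le_trans (Ideal.height_le_card_of_mem_minimalPrimes_span_finset (s := s) ?_)
    (Nat.cast_le.mpr hcard)
  refine ⟨⟨Ideal.isPrime_map_quotientMk_of_isPrime hKP, Ideal.span_le.mpr ?_⟩, ?_⟩
  · intro x hx
    simp only [s, Finset.coe_insert, Finset.coe_image, Finset.coe_univ, Set.image_univ,
      Set.mem_insert_iff, Set.mem_range] at hx
    obtain rfl | ⟨i, rfl⟩ := hx
    · exact Ideal.mem_map_of_mem _ (hC.mpr htq)
    · exact Ideal.mem_map_of_mem _ (hX i)
  · rintro N ⟨hN, hsN⟩ hNP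
    rw [Ideal.map_le_iff_le_comap]
    set N' := N.comap (Ideal.Quotient.mk K)
    have hN' : N' ≤ P := by
      refine (Ideal.comap_mono hNP).trans ?_
      rw [Ideal.comap_map_of_surjective' _ Ideal.Quotient.mk_surjective, Ideal.mk_ker]
      exact sup_le le_rfl hKP
    have hXN (i : σ) : X i ∈ N' :=
      hsN (Ideal.subset_span (by simp [s]))
    have htN : C t ∈ N' := hsN (Ideal.subset_span (by simp [s]))
    have hKN : K ≤ N' := by
      intro x hx
      rw [Ideal.mem_comap, Ideal.Quotient.eq_zero_iff_mem.mpr hx]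
      exact zero_mem _
    have hNq : N'.under A = q := by
      refine hcov _ inferInstance (SetLike.lt_iff_le_and_exists.mpr ⟨?_, t, htN, htp⟩) ?_
      · exact fun a ha ↦ hKN (Ideal.mem_map_of_mem _ ha)
      · exact hP ▸ Ideal.comap_mono hN'
    have key (f : MvPolynomial σ A) : f - C (constantCoeff f) ∈ N' := by
      induction f using MvPolynomial.induction_on with
      | C a => simp
      | add f g hf hg =>
        convert add_mem hf hg using 1
        simp only [map_add]; ring
      | mul_X f i _ => simpa using N'.mul_mem_left _ (hXN i)
    intro f hf
    have h1 : constantCoeff f ∈ q := by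
      rw [← hC]
      simpa using sub_mem hf (hN' (key f))
    rw [← hNq] at h1
    simpa using add_mem (key f) h1

/-- The substitution sending the variable `none` to `T⁻¹`, the variable `i` to `aᵢT` for `i ∈ t`,
and fixing the other variables. -/
noncomputable def laurentSubst {A ι : Type*} [CommRing A] (a : ι → A) (t : Finset ι)
    [DecidableEq ι] : MvPolynomial (Option ι) A →ₐ[A] MvPolynomial ι A[T;T⁻¹] :=
  aeval fun o ↦ o.elim (C (T (-1)))
    fun i ↦ if i ∈ t then C (LaurentPolynomial.C (a i) * T 1) else X i

theorem card_le_height_ker_laurentSubst {A ι : Type*} [CommRing A] [IsDomain A]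
    [DecidableEq ι] (a : ι → A) (t : Finset ι) :
    (t.card : ℕ∞) ≤ (RingHom.ker (laurentSubst a t)).height := by
  induction t using Finset.induction with
  | empty => simp
  | insert i t hi ih =>
    have hprime (t : Finset ι) : (RingHom.ker (laurentSubst a t)).IsPrime := RingHom.ker_isPrime _
    have hlt : RingHom.ker (laurentSubst a t) < RingHom.ker (laurentSubst a (insert i t)) := by
      let e : MvPolynomial ι A[T;T⁻¹] →ₐ[A[T;T⁻¹]] MvPolynomial ι A[T;T⁻¹] :=
        aeval fun j ↦ if j = i then C (LaurentPolynomial.C (a i) * T 1) else X j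
      have he : laurentSubst a (insert i t) =
          (e.restrictScalars A).comp (laurentSubst a t) := by
        refine MvPolynomial.algHom_ext fun o ↦ ?_
        cases o with
        | none => simp [laurentSubst, e]
        | some j =>
          by_cases hj : j ∈ t
          · simp [laurentSubst, e, hj]
          · by_cases hji : j = i
            · subst hji; simp [laurentSubst, e, hj]
            · simp [laurentSubst, e, hj, hji]
      refine SetLike.lt_iff_le_and_exists.mpr
        ⟨fun x hx ↦ ?_, X none * X (some i) - C (a i), ?_, fun h ↦ ?_⟩
      · rw [RingHom.mem_ker] at hx ⊢
        rw [he, AlgHom.comp_apply, hx, map_zero]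
      · have : (T (-1) * (LaurentPolynomial.C (a i) * T 1) : A[T;T⁻¹]) =
            LaurentPolynomial.C (a i) := by
          rw [mul_left_comm, ← T_add]; simp
        replace this := congrArg (C (σ := ι)) this
        rw [C_mul] at this
        rw [RingHom.mem_ker, laurentSubst, map_sub, map_mul, aeval_X, aeval_X, aeval_C,
          Option.elim_none, Option.elim_some, if_pos (Finset.mem_insert_self i t), this,
          sub_eq_zero]
        rfl
      · rw [RingHom.mem_ker] at h
        simp only [laurentSubst, map_sub, map_mul, aeval_X, aeval_C, Option.elim, hi,
          if_false] at h
        have := congrArg (coeff (Finsupp.single i 1)) h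
        rw [IsScalarTower.algebraMap_apply A A[T;T⁻¹] (MvPolynomial ι A[T;T⁻¹]),
          algebraMap_eq] at this
        rw [coeff_sub, coeff_C_mul, coeff_X, if_pos rfl,
          coeff_C, if_neg (Finsupp.single_ne_zero.mpr one_ne_zero).symm] at this
        exact (isUnit_T (R := A) (-1)).ne_zero (by simpa using this)
    rw [Finset.card_insert_of_notMem hi, Nat.cast_succ]
    exact le_trans (by gcongr) (Ideal.height_add_one_le_of_lt_of_isPrime hlt)

end MvPolynomial

namespace extendedReesAlgebra

variable {A : Type*} [CommRing A] {I : Ideal A} {s : Finset A}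

/-- The presentation of the extended Rees algebra of `I` attached to a finite generating set
of `I`. -/
noncomputable def presentation (hs : Ideal.span (s : Set A) = I) :
    MvPolynomial (Option s) A →ₐ[A] extendedReesAlgebra I :=
  MvPolynomial.aeval fun o ↦ o.elim (invT I) fun a ↦ smulT ⟨a, hs ▸ Ideal.subset_span a.2⟩

theorem presentation_surjective (hs : Ideal.span (s : Set A) = I) :
    Function.Surjective (presentation hs) := by
  rintro ⟨f, hf⟩
  have hrange : ((extendedReesAlgebra I).val.comp (presentation hs)).range =
      extendedReesAlgebra I := by
    rw [presentation, MvPolynomial.comp_aeval, ← Algebra.adjoin_range_eq_range_aeval]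
    refine Eq.trans ?_ (adjoin_eq_top hs)
    congr 1
    ext x
    simp [Option.exists, eq_comm, invT, smulT]
  rw [← hrange] at hf
  obtain ⟨g, hg⟩ := hf
  exact ⟨g, Subtype.ext hg⟩

theorem card_le_height_ker_presentation [IsDomain A] (hs : Ideal.span (s : Set A) = I) :
    (s.card : ℕ∞) ≤ (RingHom.ker (presentation hs)).height := by
  classical
  have hcomp : (MvPolynomial.laurentSubst (Subtype.val : s → A) Finset.univ) =
      ((IsScalarTower.toAlgHom A A[T;T⁻¹] (MvPolynomial s A[T;T⁻¹])).comp
        (extendedReesAlgebra I).val).comp (presentation hs) := by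
    refine MvPolynomial.algHom_ext fun o ↦ ?_
    cases o <;>
      simp [MvPolynomial.laurentSubst, presentation, MvPolynomial.algebraMap_eq, invT, smulT]
  have hker : RingHom.ker (MvPolynomial.laurentSubst (Subtype.val : s → A) Finset.univ) =
      RingHom.ker (presentation hs) := by
    ext x
    rw [RingHom.mem_ker, RingHom.mem_ker, hcomp, AlgHom.comp_apply]
    refine map_eq_zero_iff _ ?_
    exact (MvPolynomial.C_injective s A[T;T⁻¹]).comp Subtype.val_injective
  rw [← hker]
  simpa using MvPolynomial.card_le_height_ker_laurentSubst (Subtype.val : s → A) Finset.univ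

end extendedReesAlgebra

theorem Ideal.exists_minimalPrimes_height_add_height_le {B R : Type*} [CommRing B] [CommRing R]
    [IsNoetherianRing R] (φ : B →+* R) (hφ : Function.Surjective φ) {K : Ideal B}
    {U M : Ideal R} (hKU : K ≤ U.comap φ) (hUM : U ≤ M) [M.IsPrime] :
    ∃ P ∈ U.minimalPrimes,
      ((P.comap φ).map (Ideal.Quotient.mk K)).height + (M.map (Ideal.Quotient.mk U)).height ≤
        ((M.comap φ).map (Ideal.Quotient.mk K)).height := by
  let g : B ⧸ K →+* R ⧸ U := Ideal.quotientMap U φ hKU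
  have hg : Function.Surjective g := Ideal.quotientMap_surjective hφ
  have map_comap (N : Ideal (R ⧸ U)) :
      ((N.comap (Ideal.Quotient.mk U)).comap φ).map (Ideal.Quotient.mk K) = N.comap g := by
    rw [← Ideal.map_comap_of_surjective _ Ideal.Quotient.mk_surjective (N.comap g)]
    rfl
  set M' := M.map (Ideal.Quotient.mk U)
  have hM'prime : M'.IsPrime := Ideal.isPrime_map_quotientMk_of_isPrime hUM
  have hM'comap : M'.comap (Ideal.Quotient.mk U) = M := by
    rw [Ideal.comap_map_of_surjective' _ Ideal.Quotient.mk_surjective, Ideal.mk_ker]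
    exact sup_eq_left.mpr hUM
  obtain ⟨l, hl, hlen⟩ := Ideal.exists_ltSeries_length_eq_height M'
  obtain ⟨P', hP', hP'l⟩ := Ideal.exists_minimalPrimes_le (bot_le : ⊥ ≤ l.head.asIdeal)
  refine ⟨P'.comap (Ideal.Quotient.mk U), ?_, ?_⟩
  · rw [Ideal.minimalPrimes_eq_comap]
    exact ⟨P', hP', rfl⟩
  · let F := PrimeSpectrum.comap g
    have hF : StrictMono F := Monotone.strictMono_of_injective
      (fun _ _ h ↦ Ideal.comap_mono h) (PrimeSpectrum.comap_injective_of_surjective _ hg)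
    have := (l.map F hF).height_head_add_length_le
    rw [LTSeries.head_map, LTSeries.last_map, hl, ← PrimeSpectrum.height_eq_orderHeight,
      ← PrimeSpectrum.height_eq_orderHeight] at this
    rw [map_comap, ← hlen]
    have hM : (M.comap φ).map (Ideal.Quotient.mk K) = M'.comap g := by
      rw [← map_comap, hM'comap]
    rw [hM]
    refine le_trans ?_ this
    gcongr
    · exact Ideal.comap_mono hP'l
    · rfl

open extendedReesAlgebra in
theorem Ideal.height_le_height_add_one_of_pow_saturated {A : Type*} [CommRing A] [IsDomain A]
    [IsNoetherianRing A] {p q : Ideal A} [p.IsPrime] [q.IsPrime] (hpq : p < q)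
    (hcov : ∀ N : Ideal A, N.IsPrime → p < N → N ≤ q → N = q)
    (hp : ∀ (n : ℕ) (s c : A), s ∉ p → s * c ∈ p ^ n → c ∈ p ^ n) :
    q.height ≤ p.height + 1 := by
  obtain ⟨s, hs⟩ := (IsNoetherian.noetherian p : p.FG)
  set M := RingHom.ker (constantCoeffMod hpq.le)
  have hMprime : M.IsPrime := RingHom.ker_isPrime _
  have hMalg (a : A) : algebraMap A _ a ∈ M ↔ a ∈ q := by
    rw [← Ideal.Quotient.eq_zero_iff_mem (I := q)]
    change Ideal.Quotient.mk q ((algebraMap A A[T;T⁻¹] a).coeff 0) = 0 ↔ _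
    simp [← C_eq_algebraMap]
  have huM : invT p ∈ M := by
    change Ideal.Quotient.mk q ((T (-1) : A[T;T⁻¹]).coeff 0) = 0
    simp
  have hsmulM (a : p) : smulT a ∈ M := by
    change Ideal.Quotient.mk q ((LaurentPolynomial.C a.1 * T 1 : A[T;T⁻¹]).coeff 0) = 0
    rw [← single_eq_C_mul_T, AddMonoidAlgebra.coeff_single, Finsupp.single_apply,
      if_neg one_ne_zero, map_zero]
  set U := Ideal.span {invT p}
  have hUM : U ≤ M := (Ideal.span_singleton_le_iff_mem _).mpr huM
  set φ := presentation hs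
  have hφ : Function.Surjective φ := presentation_surjective hs
  set K := p.map (algebraMap A (MvPolynomial (Option s) A))
  have hKU : K ≤ U.comap φ.toRingHom := by
    refine Ideal.map_le_iff_le_comap.mpr fun a ha ↦ ?_
    change φ (algebraMap A _ a) ∈ U
    rw [AlgHom.commutes, algebraMap_eq_invT_mul_smulT ⟨a, ha⟩]
    exact U.mul_mem_right _ (Ideal.mem_span_singleton_self _)
  obtain ⟨P, hP, bound_chain⟩ :=
    Ideal.exists_minimalPrimes_height_add_height_le φ.toRingHom hφ hKU hUM
  change ((P.comap φ).map (Ideal.Quotient.mk K)).height + _ ≤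
    ((M.comap φ).map (Ideal.Quotient.mk K)).height at bound_chain
  have hPprime : P.IsPrime := hP.isPrime
  have hunder (N : Ideal (extendedReesAlgebra p)) : (N.comap φ).under A = N.under A := by
    ext a
    change φ (algebraMap A _ a) ∈ N ↔ algebraMap A _ a ∈ N
    rw [AlgHom.commutes]
  have hPp : (P.comap φ).LiesOver p := ⟨by rw [hunder, under_eq_of_mem_minimalPrimes hp hP]⟩
  have hMq : (M.comap φ).under A = q := by
    rw [hunder]
    ext a
    exact hMalg a
  have bound_M : ((M.comap φ).map (Ideal.Quotient.mk K)).height ≤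
      (Fintype.card (Option s) + 1 : ℕ) := by
    refine MvPolynomial.height_map_quotientMk_le_card_add_one hpq hcov _ (fun o ↦ ?_) hMq
    rw [Ideal.mem_comap]
    cases o with
    | none => simpa [φ, presentation] using huM
    | some a => simpa [φ, presentation] using hsmulM _
  have bound_P : (s.card + 1 : ℕ∞) ≤ (P.comap φ).height := by
    have hlt : RingHom.ker φ < P.comap φ := by
      refine SetLike.lt_iff_le_and_exists.mpr
        ⟨Ideal.ker_le_comap _, MvPolynomial.X none, ?_, fun h ↦ ?_⟩
      · simpa [φ, presentation] using hP.le (Ideal.mem_span_singleton_self _)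
      · have : invT p = 0 := by simpa [φ, presentation] using h
        exact (isUnit_T (R := A) (-1)).ne_zero (congrArg Subtype.val this)
    have : (RingHom.ker φ).IsPrime := RingHom.ker_isPrime _
    refine le_trans ?_ (Ideal.height_add_one_le_of_lt_of_isPrime hlt)
    gcongr
    exact card_le_height_ker_presentation hs
  have bound_P' := Ideal.height_le_height_add_of_liesOver p (P.comap φ)
  have bound_q := (height_add_one_le_height_ker_constantCoeffMod hpq.le).trans
    (Ideal.height_le_height_add_one_of_mem huM)
  change _ ≤ (M.map (Ideal.Quotient.mk U)).height + 1 at bound_q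
  rw [Fintype.card_option, Fintype.card_coe] at bound_M
  change _ ≤ _ + ((P.comap φ).map (Ideal.Quotient.mk K)).height at bound_P'
  obtain ⟨h, hh⟩ := ENat.ne_top_iff_exists.mp (Ideal.height_ne_top_of_isPrime (I := p))
  obtain ⟨d, hd⟩ := ENat.ne_top_iff_exists.mp (Ideal.height_ne_top_of_isPrime (I := q))
  have bound := bound_chain.trans bound_M
  have bound' := bound_P.trans bound_P'
  obtain ⟨k, hk⟩ := ENat.ne_top_iff_exists.mp
    (ne_top_of_le_ne_top (ENat.natCast_ne_top _) (le_self_add.trans bound))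
  obtain ⟨m, hm⟩ := ENat.ne_top_iff_exists.mp
    (ne_top_of_le_ne_top (ENat.natCast_ne_top _) (le_add_self.trans bound))
  rw [← hk] at bound bound'
  rw [← hm] at bound bound_q
  rw [← hh] at bound' ⊢
  rw [← hd] at bound_q ⊢
  norm_cast at bound bound' bound_q ⊢
  lia

theorem mem_pow_of_symbolicPower_eq {A : Type*} [CommRing A] {p : Ideal A} [p.IsPrime]
    (hp : ∀ n, 2 ≤ n → symbolicPower A p n = p ^ n) (n : ℕ) (s c : A) (hs : s ∉ p)
    (hsc : s * c ∈ p ^ n) : c ∈ p ^ n := by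
  obtain rfl | rfl | hn : n = 0 ∨ n = 1 ∨ 2 ≤ n := by lia
  · simp
  · rw [pow_one] at hsc ⊢
    exact (Ideal.IsPrime.mem_or_mem ‹_› hsc).resolve_left hs
  · rw [← hp n hn, symbolicPower, Ideal.mem_comap]
    have hunit : IsUnit (algebraMap A (Localization.AtPrime p) s) :=
      IsLocalization.map_units _ (⟨s, hs⟩ : p.primeCompl)
    rw [← Ideal.unit_mul_mem_iff_mem _ hunit, ← map_mul]
    exact Ideal.mem_map_of_mem _ hsc

theorem isCatenary_of_height_le_height_add_one {A : Type*} [CommRing A] [IsNoetherianRing A]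
    (h : ∀ p q : PrimeSpectrum A, p ⋖ q → q.asIdeal.height ≤ p.asIdeal.height + 1) :
    IsCatenary A := by
  have key (c : LTSeries (PrimeSpectrum A))
      (hc : ∀ i : Fin c.length, c.toFun i.castSucc ⋖ c.toFun i.succ) :
      c.last.asIdeal.height = c.head.asIdeal.height + c.length := by
    refine le_antisymm ?_ ?_
    · suffices H : ∀ i : Fin (c.length + 1),
          (c.toFun i).asIdeal.height ≤ c.head.asIdeal.height + (i : ℕ) from H (Fin.last _)
      intro i
      induction i using Fin.induction with
      | zero => simp; rfl
      | succ i ih =>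
        refine (h _ _ (hc i)).trans ?_
        simpa [add_assoc] using add_le_add_left ih 1
    · simpa only [PrimeSpectrum.height_eq_orderHeight] using c.height_head_add_length_le
  intro c d hhead hlast hc hd
  have hcd := key c hc
  rw [hlast, key d hd, hhead] at hcd
  obtain ⟨h, hh⟩ := ENat.ne_top_iff_exists.mp
    (Ideal.height_ne_top_of_isPrime (I := d.head.asIdeal))
  rw [← hh] at hcd
  norm_cast at hcd
  lia

/-- Let `A` be an integrally closed local Noetherian domain which is not
catenary. Then there exist a prime ideal `p` of `A` and an integer `n ≥ 2` such that
`p^(n) ≠ pⁿ`. -/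
theorem statement19 (A : Type*) [CommRing A] [IsDomain A] [IsNoetherianRing A]
    [IsLocalRing A] [IsIntegrallyClosed A] (hA : ¬ IsCatenary A) :
    ∃ (p : Ideal A) (_ : p.IsPrime) (n : ℕ), 2 ≤ n ∧ symbolicPower A p n ≠ p ^ n := by
  by_contra! H
  refine hA (isCatenary_of_height_le_height_add_one fun p q hpq ↦ ?_)
  refine Ideal.height_le_height_add_one_of_pow_saturated hpq.lt (fun N hN hpN hNq ↦ ?_)
    (mem_pow_of_symbolicPower_eq (H p.asIdeal p.isPrime))
  by_contra hne
  exact hpq.2 (c := ⟨N, hN⟩) hpN (lt_of_le_of_ne hNq fun h ↦ hne (congrArg PrimeSpectrum.asIdeal h))
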